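/- Let n ≥ 1 and let Λ be an (n+1)×(n+1) real matrix with ΛᵀηΛ = η and Λ⁰⁰ > 0 (an orthochronous Lorentz transformation), and let φ_Λ : ℝ^n → ℝ^n be the induced map on the hyperboloid chart, P̃(φ_Λ(k)) = ΛP̃(k). Then φ_Λ preserves the hyperbolic volume measure: for every measurable f : ℝ^n → [0,∞], ∫_{ℝ^n} f(φ_Λ(k)) (1+|k|²)^{−1/2} dk = ∫_{ℝ^n} f(k) (1+|k|²)^{−1/2} dk. Consequently, for m > 0 and any function ω : ℝ^n → ℝ, the SPI transformation a(y) ↦ e^{−i m ω(y)} a(φ_Λ(y)) on scattering data of massive fields preserves the norm ‖a‖² = ∫ |a(k)|² (1+|k|²)^{−1/2} dk, i.e. the representation of the SPI group on massive scattering data is unitary. -/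

import Mathlib

open scoped BigOperators
open Filter MeasureTheory ENNReal
open scoped Matrix

noncomputable section

/-- Minkowski inner product on `ℝ^{1,n}` (mostly plus signature). -/
def minkowski (n : ℕ) (X Y : Fin (n+1) → ℝ) : ℝ :=
  -(X 0 * Y 0) + ∑ i : Fin n, X i.succ * Y i.succ

/-- Parametrization of the future unit hyperboloid `H^n ⊂ ℝ^{1,n}`. -/
def hyp (n : ℕ) (y : Fin n → ℝ) : Fin (n+1) → ℝ :=
  Fin.cons (Real.sqrt (1 + ∑ i, y i ^ 2)) y

/-- The Minkowski metric as a matrix, `η = diag(-1, 1, …, 1)`. -/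
def etaMat (n : ℕ) : Matrix (Fin (n+1)) (Fin (n+1)) ℝ :=
  Matrix.diagonal (fun i => if i = 0 then (-1 : ℝ) else 1)

/-- An orthochronous Lorentz transformation: `Λᵀ η Λ = η` and `Λ⁰⁰ > 0`. -/
def IsOrthochronousLorentz (n : ℕ) (Λ : Matrix (Fin (n+1)) (Fin (n+1)) ℝ) : Prop :=
  Λᵀ * etaMat n * Λ = etaMat n ∧ 0 < Λ 0 0

/-- The map `φ_Λ` induced by a Lorentz transformation on the hyperboloid chart. -/
def lorentzBdy (n : ℕ) (Λ : Matrix (Fin (n+1)) (Fin (n+1)) ℝ) (y : Fin n → ℝ) : Fin n → ℝ :=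
  fun i => Λ.mulVec (hyp n y) i.succ

section BorderedMatrix

variable {R : Type*} [CommRing R] {n : ℕ}

/-- The block matrix `[[a, v], [w, D]]` with a scalar upper left corner. -/
def borderedMatrix (a : R) (v w : Fin n → R) (D : Matrix (Fin n) (Fin n) R) :
    Matrix (Fin (n+1)) (Fin (n+1)) R :=
  Matrix.of (Fin.cons (Fin.cons a v) fun i => Fin.cons (w i) (D i))

theorem borderedMatrix_mul (a b : R) (v w v' w' : Fin n → R) (D E : Matrix (Fin n) (Fin n) R) :
    borderedMatrix a v w D * borderedMatrix b v' w' E =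
      borderedMatrix (a * b + v ⬝ᵥ w') (a • v' + v ᵥ* E) (b • w + D *ᵥ w')
        (Matrix.vecMulVec w v' + D * E) := by
  ext i j
  refine Fin.cases ?_ (fun i => ?_) i <;> refine Fin.cases ?_ (fun j => ?_) j <;>
    simp [borderedMatrix, Matrix.mul_apply, Fin.sum_univ_succ, dotProduct, Matrix.vecMul,
      Matrix.mulVec, Matrix.vecMulVec_apply, mul_comm]

theorem det_borderedMatrix_zero_left (a : R) (v : Fin n → R) (D : Matrix (Fin n) (Fin n) R) :
    (borderedMatrix a v 0 D).det = a * D.det := by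
  have hsub : (borderedMatrix a v 0 D).submatrix Fin.succ Fin.succ = D := by
    ext i j
    simp [borderedMatrix]
  rw [Matrix.det_succ_column_zero, Fin.sum_univ_succ]
  simp only [Fin.succAbove_zero, hsub]
  simp [borderedMatrix]

theorem det_borderedMatrix_zero_top (a : R) (w : Fin n → R) (D : Matrix (Fin n) (Fin n) R) :
    (borderedMatrix a 0 w D).det = a * D.det := by
  have htr : (borderedMatrix a 0 w D)ᵀ = borderedMatrix a w 0 Dᵀ := by
    ext i j
    refine Fin.cases ?_ (fun i => ?_) i <;> refine Fin.cases ?_ (fun j => ?_) j <;>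
      simp [borderedMatrix]
  rw [← Matrix.det_transpose, htr, det_borderedMatrix_zero_left, Matrix.det_transpose]

theorem det_borderedMatrix_one (a : R) (v w : Fin n → R) :
    (borderedMatrix a v w 1).det = a - v ⬝ᵥ w := by
  have hfactor : borderedMatrix a v w 1 =
      borderedMatrix 1 v 0 1 * borderedMatrix (a - v ⬝ᵥ w) 0 w 1 := by
    rw [borderedMatrix_mul]
    simp
  rw [hfactor, Matrix.det_mul, det_borderedMatrix_zero_left, det_borderedMatrix_zero_top]
  simp

end BorderedMatrix

section Hyperboloid

variable {n : ℕ}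

theorem hyp_zero (y : Fin n → ℝ) : hyp n y 0 = √(1 + ∑ i, y i ^ 2) := rfl

theorem hyp_succ (y : Fin n → ℝ) (i : Fin n) : hyp n y i.succ = y i := rfl

theorem one_add_sum_sq_pos (y : Fin n → ℝ) : 0 < 1 + ∑ i, y i ^ 2 := by positivity

theorem hyp_zero_pos (y : Fin n → ℝ) : 0 < hyp n y 0 := Real.sqrt_pos.2 (one_add_sum_sq_pos y)

theorem hyp_zero_sq (y : Fin n → ℝ) : hyp n y 0 ^ 2 = 1 + ∑ i, y i ^ 2 :=
  Real.sq_sqrt (one_add_sum_sq_pos y).le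

theorem one_add_sum_sq_rpow (y : Fin n → ℝ) :
    (1 + ∑ i, y i ^ 2) ^ (-(1:ℝ)/2) = (hyp n y 0)⁻¹ := by
  rw [hyp_zero, Real.sqrt_eq_rpow, ← Real.rpow_neg (one_add_sum_sq_pos y).le]
  norm_num

theorem minkowski_hyp_self (y : Fin n → ℝ) : minkowski n (hyp n y) (hyp n y) = -1 := by
  have h := hyp_zero_sq y
  simp only [minkowski, hyp_succ, ← pow_two, h]
  ring

theorem eq_hyp_of_minkowski_self {X : Fin (n+1) → ℝ} (hX : minkowski n X X = -1)
    (h0 : 0 < X 0) : X = hyp n fun i => X i.succ := by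
  ext i
  refine Fin.cases ?_ (fun i => rfl) i
  rw [hyp_zero, eq_comm, Real.sqrt_eq_iff_mul_self_eq (one_add_sum_sq_pos _).le h0.le]
  simp only [minkowski, ← pow_two] at hX ⊢
  linarith

theorem minkowski_eq_dotProduct (X Y : Fin (n+1) → ℝ) :
    minkowski n X Y = X ⬝ᵥ (etaMat n *ᵥ Y) := by
  simp [minkowski, etaMat, dotProduct, Matrix.mulVec_diagonal, Fin.sum_univ_succ]

theorem etaMat_mul_self (n : ℕ) : etaMat n * etaMat n = 1 := by
  rw [etaMat, Matrix.diagonal_mul_diagonal, ← Matrix.diagonal_one]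
  congr 1
  ext i
  split_ifs <;> simp

theorem etaMat_transpose (n : ℕ) : (etaMat n)ᵀ = etaMat n := Matrix.diagonal_transpose _

/-- The derivative of `hyp n` at `k` along the `j`-th coordinate direction. -/
def hypTangent (k : Fin n → ℝ) (j : Fin n) : Fin (n+1) → ℝ :=
  Fin.cons (k j / hyp n k 0) (Pi.single j 1)

theorem minkowski_hyp_hypTangent (k : Fin n → ℝ) (j : Fin n) :
    minkowski n (hyp n k) (hypTangent k j) = 0 := by
  have h0 := (hyp_zero_pos k).ne'
  simp [minkowski, hypTangent, hyp_succ, mul_div_cancel₀ _ h0, Pi.single_apply]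

/-- The matrix with columns `hyp n k` and `hypTangent k j`. -/
def hypFrame (k : Fin n → ℝ) : Matrix (Fin (n+1)) (Fin (n+1)) ℝ :=
  borderedMatrix (hyp n k 0) (fun j => k j / hyp n k 0) k 1

theorem hypFrame_apply_zero (k : Fin n → ℝ) (i : Fin (n+1)) : hypFrame k i 0 = hyp n k i := by
  refine Fin.cases ?_ (fun i => ?_) i <;> simp [hypFrame, borderedMatrix, hyp_succ]

theorem hypFrame_apply_succ (k : Fin n → ℝ) (i : Fin (n+1)) (j : Fin n) :
    hypFrame k i j.succ = hypTangent k j i := by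
  refine Fin.cases ?_ (fun i => ?_) i <;>
    simp [hypFrame, borderedMatrix, hypTangent, Matrix.one_apply, Pi.single_apply]

theorem det_hypFrame (k : Fin n → ℝ) : (hypFrame k).det = (hyp n k 0)⁻¹ := by
  have h0 := (hyp_zero_pos k).ne'
  have hsum : (fun j => k j / hyp n k 0) ⬝ᵥ k = (∑ j, k j ^ 2) / hyp n k 0 := by
    simp only [dotProduct, Finset.sum_div]
    exact Finset.sum_congr rfl fun j _ => by ring
  rw [hypFrame, det_borderedMatrix_one, hsum]
  field_simp
  linarith [hyp_zero_sq k]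

theorem hasFDerivAt_hyp_zero (k : Fin n → ℝ) :
    HasFDerivAt (fun y => hyp n y 0)
      (∑ j, (k j / hyp n k 0) • ContinuousLinearMap.proj (R := ℝ) (φ := fun _ : Fin n => ℝ) j)
      k := by
  have hsum : HasFDerivAt (fun y : Fin n → ℝ => 1 + ∑ j, y j ^ 2)
      (∑ j, (2 * k j) • ContinuousLinearMap.proj (R := ℝ) (φ := fun _ : Fin n => ℝ) j) k := by
    refine (HasFDerivAt.fun_sum fun j _ => ?_).const_add 1
    simpa using ((ContinuousLinearMap.proj (R := ℝ) (φ := fun _ : Fin n => ℝ) j).hasFDerivAt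
      (x := k)).pow 2
  refine (hsum.sqrt (one_add_sum_sq_pos k).ne').congr_fderiv ?_
  rw [← hyp_zero, Finset.smul_sum]
  refine Finset.sum_congr rfl fun j _ => ?_
  rw [smul_smul]
  congr 1
  have h0 := (hyp_zero_pos k).ne'
  field_simp

end Hyperboloid

namespace IsOrthochronousLorentz

variable {n : ℕ} {Λ : Matrix (Fin (n+1)) (Fin (n+1)) ℝ}

theorem minkowski_mulVec (hΛ : IsOrthochronousLorentz n Λ) (X Y : Fin (n+1) → ℝ) :
    minkowski n (Λ *ᵥ X) (Λ *ᵥ Y) = minkowski n X Y := by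
  rw [minkowski_eq_dotProduct, minkowski_eq_dotProduct, ← Matrix.vecMul_transpose,
    ← Matrix.dotProduct_mulVec, Matrix.mulVec_mulVec, Matrix.mulVec_mulVec, hΛ.1]

theorem inv_mul (hΛ : IsOrthochronousLorentz n Λ) : etaMat n * Λᵀ * etaMat n * Λ = 1 := by
  rw [mul_assoc, mul_assoc, ← mul_assoc Λᵀ, hΛ.1, etaMat_mul_self]

theorem mul_inv (hΛ : IsOrthochronousLorentz n Λ) : Λ * (etaMat n * Λᵀ * etaMat n) = 1 :=
  mul_eq_one_comm.1 hΛ.inv_mul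

theorem mul_etaMat_mul_transpose (hΛ : IsOrthochronousLorentz n Λ) :
    Λ * etaMat n * Λᵀ = etaMat n := by
  calc Λ * etaMat n * Λᵀ = Λ * (etaMat n * Λᵀ * etaMat n) * etaMat n := by
        simp only [mul_assoc, etaMat_mul_self, mul_one]
    _ = etaMat n := by rw [hΛ.mul_inv, one_mul]

theorem inv (hΛ : IsOrthochronousLorentz n Λ) :
    IsOrthochronousLorentz n (etaMat n * Λᵀ * etaMat n) := by
  constructor
  · simp only [Matrix.transpose_mul, Matrix.transpose_transpose, etaMat_transpose]
    calc etaMat n * (Λ * etaMat n) * etaMat n * (etaMat n * Λᵀ * etaMat n)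
        = etaMat n * (Λ * (etaMat n * (etaMat n * etaMat n) * Λᵀ)) * etaMat n := by
          simp only [mul_assoc]
      _ = etaMat n * (Λ * etaMat n * Λᵀ) * etaMat n := by
          simp only [etaMat_mul_self, mul_one, mul_assoc]
      _ = etaMat n := by
          rw [hΛ.mul_etaMat_mul_transpose, etaMat_mul_self, one_mul]
  · simpa [etaMat, Matrix.mul_diagonal, Matrix.diagonal_mul] using hΛ.2

theorem abs_det (hΛ : IsOrthochronousLorentz n Λ) : |Λ.det| = 1 := by
  have hη : (etaMat n).det ≠ 0 := fun h => by
    simpa [h] using congrArg Matrix.det (etaMat_mul_self n)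
  have h := congrArg Matrix.det hΛ.1
  rw [Matrix.det_mul, Matrix.det_mul, Matrix.det_transpose] at h
  have hsq : Λ.det ^ 2 = 1 := mul_right_cancel₀ hη (by linear_combination h)
  exact (pow_eq_one_iff_of_nonneg (abs_nonneg _) two_ne_zero).1 ((sq_abs _).trans hsq)

theorem mulVec_hyp_zero_pos (hΛ : IsOrthochronousLorentz n Λ) (k : Fin n → ℝ) :
    0 < (Λ *ᵥ hyp n k) 0 := by
  have hrow : Λ 0 0 ^ 2 = 1 + ∑ j : Fin n, Λ 0 j.succ ^ 2 := by
    have h := congrFun (congrFun hΛ.mul_etaMat_mul_transpose 0) 0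
    rw [Matrix.mul_apply] at h
    simp only [etaMat, Matrix.mul_diagonal, Matrix.transpose_apply, Fin.sum_univ_succ] at h
    simp [← pow_two] at h
    linarith
  have hk := hyp_zero_sq k
  have hcs := Finset.sum_mul_sq_le_sq_mul_sq Finset.univ (fun j : Fin n => Λ 0 j.succ) k
  have hval : (Λ *ᵥ hyp n k) 0 = Λ 0 0 * hyp n k 0 + ∑ j, Λ 0 j.succ * k j := by
    simp [Matrix.mulVec, dotProduct, Fin.sum_univ_succ, hyp_succ]
  have hsq : (∑ j, Λ 0 j.succ * k j) ^ 2 < (Λ 0 0 * hyp n k 0) ^ 2 := by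
    have h1 : 0 ≤ ∑ j : Fin n, Λ 0 j.succ ^ 2 := by positivity
    have h2 : 0 ≤ ∑ j, k j ^ 2 := by positivity
    rw [mul_pow, hrow, hk]
    nlinarith
  have habs := abs_lt.1 (abs_lt_of_sq_lt_sq hsq (mul_pos hΛ.2 (hyp_zero_pos k)).le)
  rw [hval]
  linarith [habs.1]

theorem hyp_lorentzBdy (hΛ : IsOrthochronousLorentz n Λ) (k : Fin n → ℝ) :
    hyp n (lorentzBdy n Λ k) = Λ *ᵥ hyp n k :=
  (eq_hyp_of_minkowski_self (by rw [hΛ.minkowski_mulVec, minkowski_hyp_self])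
    (hΛ.mulVec_hyp_zero_pos k)).symm

theorem lorentzBdy_bijective (hΛ : IsOrthochronousLorentz n Λ) :
    Function.Bijective (lorentzBdy n Λ) := by
  have hcomp : ∀ {M N : Matrix (Fin (n+1)) (Fin (n+1)) ℝ}, IsOrthochronousLorentz n N →
      M * N = 1 → Function.LeftInverse (lorentzBdy n M) (lorentzBdy n N) := by
    intro M N hN hMN k
    ext i
    rw [lorentzBdy, hN.hyp_lorentzBdy, Matrix.mulVec_mulVec, hMN, Matrix.one_mulVec, hyp_succ]
  exact Function.bijective_iff_has_inverse.2
    ⟨_, hcomp hΛ hΛ.inv_mul, hcomp hΛ.inv hΛ.mul_inv⟩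

end IsOrthochronousLorentz

section LorentzJacobian

variable {n : ℕ} {Λ : Matrix (Fin (n+1)) (Fin (n+1)) ℝ}

/-- The Jacobian matrix of `lorentzBdy n Λ` at `k`. -/
def lorentzJacobian (Λ : Matrix (Fin (n+1)) (Fin (n+1)) ℝ) (k : Fin n → ℝ) :
    Matrix (Fin n) (Fin n) ℝ :=
  Matrix.of fun i j => (Λ *ᵥ hypTangent k j) i.succ

theorem hasFDerivAt_lorentzBdy (Λ : Matrix (Fin (n+1)) (Fin (n+1)) ℝ) (k : Fin n → ℝ) :
    HasFDerivAt (lorentzBdy n Λ)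
      (LinearMap.toContinuousLinearMap (Matrix.toLin' (lorentzJacobian Λ k))) k := by
  rw [hasFDerivAt_pi']
  intro i
  have hfun : (fun y => lorentzBdy n Λ y i) =
      fun y => Λ i.succ 0 * hyp n y 0 + ∑ j : Fin n, Λ i.succ j.succ * y j := by
    ext y
    simp [lorentzBdy, Matrix.mulVec, dotProduct, Fin.sum_univ_succ, hyp_succ]
  rw [hfun]
  refine (((hasFDerivAt_hyp_zero k).const_mul (Λ i.succ 0)).add
    (HasFDerivAt.fun_sum fun j _ => ((ContinuousLinearMap.proj (R := ℝ)
      (φ := fun _ : Fin n => ℝ) j).hasFDerivAt (x := k)).const_mul (Λ i.succ j.succ))).congr_fderiv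
    ?_
  ext v
  simp [lorentzJacobian, hypTangent, Matrix.mulVec, dotProduct, Fin.sum_univ_succ,
    Pi.single_apply, add_mul, Finset.sum_add_distrib, Finset.mul_sum, mul_assoc]

theorem mul_hypFrame (hΛ : IsOrthochronousLorentz n Λ) (k : Fin n → ℝ) :
    Λ * hypFrame k =
      hypFrame (lorentzBdy n Λ k) * borderedMatrix 1 0 0 (lorentzJacobian Λ k) := by
  have hmulVec : ∀ i j, (Λ * hypFrame k) i j = (Λ *ᵥ fun l => hypFrame k l j) i :=
    fun i j => rfl
  have horth (j : Fin n) : hyp n (lorentzBdy n Λ k) 0 * (Λ *ᵥ hypTangent k j) 0 =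
      ∑ i, lorentzBdy n Λ k i * lorentzJacobian Λ k i j := by
    have h := hΛ.minkowski_mulVec (hyp n k) (hypTangent k j)
    rw [minkowski_hyp_hypTangent, ← hΛ.hyp_lorentzBdy] at h
    simp only [minkowski, hyp_succ] at h
    simp only [lorentzJacobian, Matrix.of_apply]
    linarith
  have h0 := (hyp_zero_pos (lorentzBdy n Λ k)).ne'
  rw [hypFrame.eq_def (lorentzBdy n Λ k), borderedMatrix_mul]
  ext i j
  rw [hmulVec]
  refine Fin.cases ?_ (fun j => ?_) j
  · simp only [hypFrame_apply_zero]
    rw [← hΛ.hyp_lorentzBdy]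
    refine Fin.cases ?_ (fun i => ?_) i <;> simp [borderedMatrix, hyp_succ]
  · simp only [hypFrame_apply_succ]
    refine Fin.cases ?_ (fun i => ?_) i
    · rw [← mul_right_inj' h0, horth]
      simp only [borderedMatrix, Matrix.of_apply, Fin.cons_zero, Fin.cons_succ, Pi.add_apply,
        Matrix.vecMul, dotProduct, Finset.mul_sum, smul_zero, Pi.zero_apply, zero_add]
      exact Finset.sum_congr rfl fun i _ => by field_simp
    · simp [borderedMatrix, lorentzJacobian]

theorem abs_det_lorentzJacobian (hΛ : IsOrthochronousLorentz n Λ) (k : Fin n → ℝ) :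
    |(lorentzJacobian Λ k).det| = hyp n (lorentzBdy n Λ k) 0 * (hyp n k 0)⁻¹ := by
  have h := congrArg (fun M => |Matrix.det M|) (mul_hypFrame hΛ k)
  simp only [Matrix.det_mul, det_hypFrame, det_borderedMatrix_zero_left, one_mul, abs_mul,
    hΛ.abs_det, abs_inv, abs_of_pos (hyp_zero_pos _)] at h
  rw [h, mul_inv_cancel_left₀ (hyp_zero_pos _).ne']

/-- Orthochronous Lorentz transformations preserve the hyperbolic volume measure. -/
theorem lintegral_comp_lorentzBdy (hΛ : IsOrthochronousLorentz n Λ)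
    (f : (Fin n → ℝ) → ℝ≥0∞) :
    ∫⁻ k : Fin n → ℝ, f (lorentzBdy n Λ k) * ENNReal.ofReal ((1 + ∑ i, k i ^ 2) ^ (-(1:ℝ)/2)) =
      ∫⁻ k : Fin n → ℝ, f k * ENNReal.ofReal ((1 + ∑ i, k i ^ 2) ^ (-(1:ℝ)/2)) := by
  have hcov := lintegral_image_eq_lintegral_abs_det_fderiv_mul volume MeasurableSet.univ
    (fun k _ => (hasFDerivAt_lorentzBdy Λ k).hasFDerivWithinAt)
    hΛ.lorentzBdy_bijective.injective.injOn
    (fun k => f k * ENNReal.ofReal ((1 + ∑ i, k i ^ 2) ^ (-(1:ℝ)/2)))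
  rw [Set.image_univ, hΛ.lorentzBdy_bijective.surjective.range_eq, setLIntegral_univ,
    setLIntegral_univ] at hcov
  rw [hcov]
  refine lintegral_congr fun k => ?_
  have hdet : (LinearMap.toContinuousLinearMap (Matrix.toLin' (lorentzJacobian Λ k))).det =
      (lorentzJacobian Λ k).det := LinearMap.det_toLin' _
  have hpos := hyp_zero_pos (lorentzBdy n Λ k)
  rw [hdet, abs_det_lorentzJacobian hΛ, one_add_sum_sq_rpow, one_add_sum_sq_rpow,
    mul_left_comm, ← ENNReal.ofReal_mul (mul_pos hpos (inv_pos.2 (hyp_zero_pos k))).le,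
    mul_right_comm, mul_inv_cancel₀ hpos.ne', one_mul]

end LorentzJacobian

/-- The map `φ_Λ` preserves the hyperbolic volume measure `(1+|k|²)^{-1/2}dk`;
consequently the SPI transformation `a(y) ↦ e^{-imω(y)}a(φ_Λ(y))` on massive scattering
data preserves the norm `‖a‖² = ∫|a|²(1+|k|²)^{-1/2}dk`, i.e. the representation of the
SPI group on massive scattering data is unitary. -/
theorem spi_representation_is_unitary
    (n : ℕ) (hn : 1 ≤ n) (Λ : Matrix (Fin (n+1)) (Fin (n+1)) ℝ)
    (hΛ : IsOrthochronousLorentz n Λ) :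
    (∀ f : (Fin n → ℝ) → ℝ≥0∞, Measurable f →
      ∫⁻ k : Fin n → ℝ,
          f (lorentzBdy n Λ k) * ENNReal.ofReal ((1 + ∑ i, k i ^ 2) ^ (-(1:ℝ)/2))
        = ∫⁻ k : Fin n → ℝ,
            f k * ENNReal.ofReal ((1 + ∑ i, k i ^ 2) ^ (-(1:ℝ)/2))) ∧
    (∀ m : ℝ, 0 < m → ∀ (ω : (Fin n → ℝ) → ℝ) (a : (Fin n → ℝ) → ℂ), Measurable a →
      ∫⁻ y : Fin n → ℝ,
          (‖Complex.exp (-(Complex.I * (m : ℂ) * (ω y : ℂ))) * a (lorentzBdy n Λ y)‖₊ : ℝ≥0∞) ^ 2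
            * ENNReal.ofReal ((1 + ∑ i, y i ^ 2) ^ (-(1:ℝ)/2))
        = ∫⁻ y : Fin n → ℝ,
            (‖a y‖₊ : ℝ≥0∞) ^ 2 * ENNReal.ofReal ((1 + ∑ i, y i ^ 2) ^ (-(1:ℝ)/2))) := by
  have invariance := fun (f : (Fin n → ℝ) → ℝ≥0∞) => lintegral_comp_lorentzBdy hΛ f
  refine ⟨fun f _ => invariance f, fun m _ ω a _ => ?_⟩
  rw [← invariance fun y => (‖a y‖₊ : ℝ≥0∞) ^ 2]
  refine lintegral_congr fun y => ?_
  have hphase : ‖Complex.exp (-(Complex.I * (m : ℂ) * (ω y : ℂ)))‖₊ = 1 := by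
    rw [← NNReal.coe_inj, coe_nnnorm, Complex.norm_exp]
    simp
  rw [nnnorm_mul, hphase, one_mul]
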